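/- Let {f_i}_{i∈I_c} and {g_j}_{j∈I_d} be families of flow and jump maps, let h⁰, h ∈ H, let J ⊂ I_c × I_c × I_d be nonempty, and let SW ⊂ SW(J) be a family of impulsive and switching sequences. Let Assumption 3 hold. If there exist η, μ > 0 such that for every σ ∈ SW, n^{σ,s}_{(t_0,t]} ln(d_s) + n^{σ,u}_{(t_0,t]} ln(d_u) − c_s T^{σ,s}_{(t_0,t]} + c_u T^{σ,u}_{(t_0,t]} ≤ μ − η[t−t_0 + n^σ_{(t_0,t]}] for all t ≥ t_0 ≥ 0 (with the conventions 0·ln(0) = 0 and r·ln(0) = −∞ for r > 0), then the family {Σ_σ}_{σ∈SW} is strongly (h⁰,h)-ISS. -/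

import Mathlib

open MeasureTheory Filter Set
open scoped Classical

noncomputable section

/-- State/input spaces: `ℝ^k` with the Euclidean norm. -/
abbrev Stt (k : ℕ) : Type := EuclideanSpace ℝ (Fin k)

/-- An impulse-time sequence, identified with its (locally finite) set of impulse
times, a subset of `(0,∞)` with finitely many points below any bound. -/
def IsImpulseSeq (γ : Set ℝ) : Prop :=
  γ ⊆ Set.Ioi (0 : ℝ) ∧ ∀ T : ℝ, (γ ∩ Set.Iic T).Finite

/-- `n^γ_{(s,t]}`: the number of impulse times in the interval `(s,t]`. -/
def nJumps (γ : Set ℝ) (s t : ℝ) : ℕ := (γ ∩ Set.Ioc s t).ncard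

/-- Uniform incremental boundedness of a set of impulse-time sequences. -/
def UIB (S : Set (Set ℝ)) : Prop :=
  ∃ φ : ℝ → ℝ, ContinuousOn φ (Set.Ici 0) ∧ MonotoneOn φ (Set.Ici 0) ∧
    (∀ s : ℝ, 0 ≤ s → 0 ≤ φ s) ∧
    ∀ γ ∈ S, ∀ t0 t : ℝ, 0 ≤ t0 → t0 < t → (nJumps γ t0 t : ℝ) ≤ φ (t - t0)

/-- Class `K∞` functions `[0,∞) → [0,∞)`. -/
def ClassKInf (α : ℝ → ℝ) : Prop :=
  ContinuousOn α (Set.Ici 0) ∧ StrictMonoOn α (Set.Ici 0) ∧ α 0 = 0 ∧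
    ∀ M : ℝ, ∃ r : ℝ, 0 ≤ r ∧ M ≤ α r

/-- Class `KL` functions. -/
def ClassKL (β : ℝ → ℝ → ℝ) : Prop :=
  (∀ t : ℝ, 0 ≤ t → ClassKInf fun r => β r t) ∧
  ∀ r : ℝ, 0 ≤ r → AntitoneOn (fun t => β r t) (Set.Ici 0) ∧
    Filter.Tendsto (fun t => β r t) Filter.atTop (nhds 0)

/-- Positive definite functions `[0,∞) → [0,∞)`. -/
def PosDef (ρ : ℝ → ℝ) : Prop :=
  ContinuousOn ρ (Set.Ici 0) ∧ ρ 0 = 0 ∧ ∀ r : ℝ, 0 < r → 0 < ρ r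

/-- Locally integrable (on compacts) function `[0,∞) → ℝ` (extended to `ℝ`). -/
def LocIntegrable (p : ℝ → ℝ) : Prop :=
  ∀ a b : ℝ, MeasureTheory.IntegrableOn p (Set.Icc a b)

/-- Inputs: measurable, locally essentially bounded functions. -/
def IsInput {m : ℕ} (u : ℝ → Stt m) : Prop :=
  Measurable u ∧ ∀ T : ℝ, ∃ C : ℝ, ∀ᵐ t ∂MeasureTheory.volume, t ∈ Set.Icc 0 T → ‖u t‖ ≤ C

/-- `‖u_I‖_γ`: max of the essential supremum of `‖u‖` over `I` and the supremum of
`‖u‖` over `γ ∩ I`. -/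
def inputNorm {m : ℕ} (γ : Set ℝ) (u : ℝ → Stt m) (I : Set ℝ) : ℝ :=
  max (essSup (fun t => ‖u t‖) (MeasureTheory.volume.restrict I))
      (sSup ((fun t => ‖u t‖) '' (γ ∩ I)))

/-- Solution of the impulsive system `(γ,f,g)` on `[t0,T)` with initial state `x0`
and input `u` (Carathéodory solutions, in integral form, between impulses). -/
structure IsSolution {n m : ℕ} (γ : Set ℝ) (f g : ℝ → Stt n → Stt m → Stt n)
    (t0 : ℝ) (x0 : Stt n) (u : ℝ → Stt m) (T : EReal) (x : ℝ → Stt n) : Prop where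
  lt : (t0 : EReal) < T
  init : x t0 = x0
  flow : ∀ t1 t2 : ℝ, t0 ≤ t1 → t1 ≤ t2 → (t2 : EReal) < T → Set.Ioc t1 t2 ∩ γ = ∅ →
    MeasureTheory.IntegrableOn (fun s => f s (x s) (u s)) (Set.Icc t1 t2) ∧
    x t2 = x t1 + ∫ s in t1..t2, f s (x s) (u s)
  jump : ∀ t ∈ γ, t0 < t → (t : EReal) < T →
    ∃ L : Stt n, Filter.Tendsto x (nhdsWithin t (Set.Iio t)) (nhds L) ∧
      x t = L + g t L (u t)

/-- Maximally defined solution. -/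
def IsMaxSolution {n m : ℕ} (γ : Set ℝ) (f g : ℝ → Stt n → Stt m → Stt n)
    (t0 : ℝ) (x0 : Stt n) (u : ℝ → Stt m) (T : EReal) (x : ℝ → Stt n) : Prop :=
  IsSolution γ f g t0 x0 u T x ∧
    ∀ (T' : EReal) (x' : ℝ → Stt n), IsSolution γ f g t0 x0 u T' x' →
      (∀ t : ℝ, t0 ≤ t → (t : EReal) < T → x' t = x t) → T' ≤ T

/-- Weak `(h⁰,h)`-ISS of a parametrized family of impulsive systems. -/
def WeaklyISS {n m : ℕ} {Λ : Type*} (γ : Λ → Set ℝ)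
    (f g : Λ → ℝ → Stt n → Stt m → Stt n) (h0 h : ℝ → Stt n → ℝ) : Prop :=
  ∃ β : ℝ → ℝ → ℝ, ∃ ρ : ℝ → ℝ, ClassKL β ∧ ClassKInf ρ ∧
    ∀ (l : Λ) (t0 : ℝ) (x0 : Stt n) (u : ℝ → Stt m) (T : EReal) (x : ℝ → Stt n),
      0 ≤ t0 → IsInput u → IsMaxSolution (γ l) (f l) (g l) t0 x0 u T x →
      ∀ t : ℝ, t0 ≤ t → (t : EReal) < T →
        h t (x t) ≤ β (h0 t0 x0) (t - t0) + ρ (inputNorm (γ l) u (Set.Ioc t0 t))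

/-- Strong `(h⁰,h)`-ISS of a parametrized family of impulsive systems. -/
def StronglyISS {n m : ℕ} {Λ : Type*} (γ : Λ → Set ℝ)
    (f g : Λ → ℝ → Stt n → Stt m → Stt n) (h0 h : ℝ → Stt n → ℝ) : Prop :=
  ∃ β : ℝ → ℝ → ℝ, ∃ ρ : ℝ → ℝ, ClassKL β ∧ ClassKInf ρ ∧
    ∀ (l : Λ) (t0 : ℝ) (x0 : Stt n) (u : ℝ → Stt m) (T : EReal) (x : ℝ → Stt n),
      0 ≤ t0 → IsInput u → IsMaxSolution (γ l) (f l) (g l) t0 x0 u T x →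
      ∀ t : ℝ, t0 ≤ t → (t : EReal) < T →
        h t (x t) ≤ β (h0 t0 x0) (t - t0 + (nJumps (γ l) t0 t : ℝ)) +
          ρ (inputNorm (γ l) u (Set.Ioc t0 t))

/-- Locally Lipschitz on a set. -/
def LocLipschitzOn {α β : Type*} [PseudoEMetricSpace α] [PseudoEMetricSpace β]
    (s : Set α) (f : α → β) : Prop :=
  ∀ x ∈ s, ∃ K : NNReal, ∃ t ∈ nhdsWithin x s, LipschitzOnWith K f t

/-- `V ∈ V(γ)` with `Vm` its left-limit function at impulse times: `V` is locally
Lipschitz on each inter-impulse strip and has the joint left limit `Vm τ ξ`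
at each `τ ∈ γ`. -/
def InClassV {n : ℕ} (γ : Set ℝ) (V Vm : ℝ → Stt n → ℝ) : Prop :=
  (∀ a b : ℝ, 0 ≤ a → Set.Ioo a b ∩ γ = ∅ →
    LocLipschitzOn (Set.Ico a b ×ˢ (Set.univ : Set (Stt n)))
      (fun q : ℝ × Stt n => V q.1 q.2)) ∧
  ∀ τ ∈ γ, ∀ ξ : Stt n,
    Filter.Tendsto (fun q : ℝ × Stt n => V q.1 q.2)
      (nhdsWithin (τ, ξ) (Set.Iio τ ×ˢ (Set.univ : Set (Stt n)))) (nhds (Vm τ ξ))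

/-- Upper-right Dini derivative of `V` along the flow map `f`. -/
def DiniAlong {n m : ℕ} (f : ℝ → Stt n → Stt m → Stt n) (V : ℝ → Stt n → ℝ)
    (t : ℝ) (ξ : Stt n) (μ : Stt m) : ℝ :=
  Filter.limsup (fun d : ℝ => (V (t + d) (ξ + d • f t ξ μ) - V t ξ) / d)
    (nhdsWithin 0 (Set.Ioi 0))

/-- Carathéodory function `[0,∞) × [0,∞) → ℝ`. -/
def Caratheodory2 (φ : ℝ → ℝ → ℝ) : Prop :=
  (∀ r : ℝ, Measurable fun t => φ t r) ∧
  (∀ t : ℝ, ContinuousOn (φ t) (Set.Ici 0)) ∧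
  ∀ a b c : ℝ, ∃ mK : ℝ → ℝ, MeasureTheory.IntegrableOn mK (Set.Icc a b) ∧
    ∀ t ∈ Set.Icc a b, ∀ r ∈ Set.Icc (0 : ℝ) c, |φ t r| ≤ mK t

/-- Assumption 1 of the paper, with all the data explicit. -/
def Assumption1 {n m : ℕ} {Λ : Type*} (γ : Λ → Set ℝ)
    (f g : Λ → ℝ → Stt n → Stt m → Stt n) (h0 h : ℝ → Stt n → ℝ)
    (V Vm : Λ → ℝ → Stt n → ℝ) (φ1 φ2 χ π : ℝ → ℝ)
    (vφ al : Λ → ℝ → ℝ → ℝ) : Prop :=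
  ClassKInf φ1 ∧ ClassKInf φ2 ∧ ClassKInf χ ∧ ClassKInf π ∧
  (∀ l : Λ, InClassV (γ l) (V l) (Vm l)) ∧
  (∀ l : Λ, Caratheodory2 (vφ l)) ∧
  (∀ (l : Λ) (t r : ℝ), 0 ≤ t → 0 ≤ r → 0 ≤ al l t r) ∧
  (∀ (l : Λ) (t : ℝ) (ξ : Stt n), 0 ≤ t →
    φ1 (h t ξ) ≤ V l t ξ ∧ V l t ξ ≤ φ2 (h0 t ξ)) ∧
  (∀ (l : Λ) (t : ℝ) (ξ : Stt n) (μ : Stt m), 0 ≤ t → t ∉ γ l → χ ‖μ‖ ≤ V l t ξ →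
    DiniAlong (f l) (V l) t ξ μ ≤ - vφ l t (V l t ξ)) ∧
  (∀ (l : Λ) (t : ℝ) (ξ : Stt n) (μ : Stt m), t ∈ γ l → χ ‖μ‖ ≤ Vm l t ξ →
    V l t (ξ + g l t ξ μ) ≤ al l t (Vm l t ξ)) ∧
  (∀ (l : Λ) (t : ℝ) (ξ : Stt n) (μ : Stt m), t ∈ γ l → Vm l t ξ ≤ χ ‖μ‖ →
    V l t (ξ + g l t ξ μ) ≤ π ‖μ‖)

/-- Solution of the scalar comparison differential/difference inclusion. -/
structure IsCompSol (γ : Set ℝ) (vφ al : ℝ → ℝ → ℝ) (t0 z0 : ℝ) (T : EReal)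
    (z : ℝ → ℝ) : Prop where
  lt : (t0 : EReal) < T
  init : z t0 = z0
  nonneg : ∀ t : ℝ, t0 ≤ t → (t : EReal) < T → 0 ≤ z t
  flow : ∀ t1 t2 : ℝ, t0 ≤ t1 → t1 ≤ t2 → (t2 : EReal) < T → Set.Ioc t1 t2 ∩ γ = ∅ →
    ∃ d : ℝ → ℝ, MeasureTheory.IntegrableOn d (Set.Icc t1 t2) ∧
      (∀ᵐ s ∂MeasureTheory.volume, s ∈ Set.Icc t1 t2 → d s ≤ - vφ s (z s)) ∧
      ∀ t ∈ Set.Icc t1 t2, z t = z t1 + ∫ s in t1..t, d s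
  jump : ∀ t ∈ γ, t0 < t → (t : EReal) < T →
    ∃ L : ℝ, Filter.Tendsto z (nhdsWithin t (Set.Iio t)) (nhds L) ∧ z t ≤ al t L

/-- The family of comparison systems is weakly GUAS. -/
def CompWeakGUAS {Λ : Type*} (γ : Λ → Set ℝ) (vφ al : Λ → ℝ → ℝ → ℝ) : Prop :=
  ∃ β : ℝ → ℝ → ℝ, ClassKL β ∧
    ∀ (l : Λ) (t0 z0 : ℝ) (T : EReal) (z : ℝ → ℝ), 0 ≤ t0 → 0 ≤ z0 →
      IsCompSol (γ l) (vφ l) (al l) t0 z0 T z →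
      ∀ t : ℝ, t0 ≤ t → (t : EReal) < T → z t ≤ β z0 (t - t0)

/-- The family of comparison systems is strongly GUAS. -/
def CompStrongGUAS {Λ : Type*} (γ : Λ → Set ℝ) (vφ al : Λ → ℝ → ℝ → ℝ) : Prop :=
  ∃ β : ℝ → ℝ → ℝ, ClassKL β ∧
    ∀ (l : Λ) (t0 z0 : ℝ) (T : EReal) (z : ℝ → ℝ), 0 ≤ t0 → 0 ≤ z0 →
      IsCompSol (γ l) (vφ l) (al l) t0 z0 T z →
      ∀ t : ℝ, t0 ≤ t → (t : EReal) < T → z t ≤ β z0 (t - t0 + (nJumps (γ l) t0 t : ℝ))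

/-- Nonnegative Carathéodory solution of the scalar ODE `ẇ = rhs(t,w)` on `[t0,T)`. -/
structure IsODESol (rhs : ℝ → ℝ → ℝ) (t0 : ℝ) (T : EReal) (w : ℝ → ℝ) : Prop where
  lt : (t0 : EReal) < T
  nonneg : ∀ t : ℝ, t0 ≤ t → (t : EReal) < T → 0 ≤ w t
  flow : ∀ t1 t2 : ℝ, t0 ≤ t1 → t1 ≤ t2 → (t2 : EReal) < T →
    IntervalIntegrable (fun s => rhs s (w s)) MeasureTheory.volume t1 t2 ∧
    w t2 = w t1 + ∫ s in t1..t2, rhs s (w s)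

/-- Maximally defined forward-in-time solution of `ẇ = rhs(t,w)`. -/
def IsMaxODESol (rhs : ℝ → ℝ → ℝ) (t0 : ℝ) (T : EReal) (w : ℝ → ℝ) : Prop :=
  IsODESol rhs t0 T w ∧
    ∀ (T' : EReal) (w' : ℝ → ℝ), IsODESol rhs t0 T' w' →
      (∀ t : ℝ, t0 ≤ t → (t : EReal) < T → w' t = w t) → T' ≤ T

/-- GUAS of the family of scalar ODEs `ẇ = −φ_λ(t,w)`. -/
def ODEFamilyGUAS {Λ : Type*} (vφ : Λ → ℝ → ℝ → ℝ) : Prop :=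
  ∃ β : ℝ → ℝ → ℝ, ClassKL β ∧
    ∀ (l : Λ) (t0 : ℝ) (T : EReal) (w : ℝ → ℝ), 0 ≤ t0 →
      IsMaxODESol (fun s r => -(vφ l s r)) t0 T w →
      T = (⊤ : EReal) ∧ ∀ t : ℝ, t0 ≤ t → w t ≤ β (w t0) (t - t0)

/-- Solution (on all of `[0,∞)`) of the scalar linear ODE `ẇ = −p(t)·w`. -/
def IsLinSol (p : ℝ → ℝ) (w : ℝ → ℝ) : Prop :=
  ∀ t1 t2 : ℝ, 0 ≤ t1 → t1 ≤ t2 →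
    IntervalIntegrable (fun s => p s * w s) MeasureTheory.volume t1 t2 ∧
    w t2 = w t1 + ∫ s in t1..t2, -(p s * w s)

/-- An impulsive and switching sequence, described through its impulse-time set,
its two switching signals (constant between impulses), and the left limit of the
first switching signal at impulse times. -/
structure SwSignal (Ic Id : Type*) where
  γ : Set ℝ
  σ1 : ℝ → Ic
  σ1m : ℝ → Ic
  σ2 : ℝ → Id
  impulse : IsImpulseSeq γ
  const1 : ∀ a b : ℝ, 0 ≤ a → Set.Ioo a b ∩ γ = ∅ → ∀ t ∈ Set.Ico a b, σ1 t = σ1 a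
  const2 : ∀ a b : ℝ, 0 ≤ a → Set.Ioo a b ∩ γ = ∅ → ∀ t ∈ Set.Ico a b, σ2 t = σ2 a
  leftlim : ∀ t ∈ γ, ∀ᶠ s in nhdsWithin t (Set.Iio t), σ1 s = σ1m t

/-- `σ ∈ SW(J)`. -/
def InSW {Ic Id : Type*} (σ : SwSignal Ic Id) (J : Set (Ic × Ic × Id)) : Prop :=
  ∀ t ∈ σ.γ, (σ.σ1m t, σ.σ1 t, σ.σ2 t) ∈ J

/-- Flow map of the switched impulsive system `Σ_σ`. -/
def swF {n m : ℕ} {Ic Id : Type*} (F : Ic → ℝ → Stt n → Stt m → Stt n)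
    (σ : SwSignal Ic Id) : ℝ → Stt n → Stt m → Stt n :=
  fun t ξ μ => F (σ.σ1 t) t ξ μ

/-- Jump map of the switched impulsive system `Σ_σ`. -/
def swG {n m : ℕ} {Ic Id : Type*} (G : Id → ℝ → Stt n → Stt m → Stt n)
    (σ : SwSignal Ic Id) : ℝ → Stt n → Stt m → Stt n :=
  fun t ξ μ => G (σ.σ2 t) t ξ μ

/-- Weak `(h⁰,h)`-ISS of the family `{Σ_σ}_{σ ∈ SW}`. -/
def SwWeaklyISS {n m : ℕ} {Ic Id : Type*} (F : Ic → ℝ → Stt n → Stt m → Stt n)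
    (G : Id → ℝ → Stt n → Stt m → Stt n) (SW : Set (SwSignal Ic Id))
    (h0 h : ℝ → Stt n → ℝ) : Prop :=
  ∃ β : ℝ → ℝ → ℝ, ∃ ρ : ℝ → ℝ, ClassKL β ∧ ClassKInf ρ ∧
    ∀ σ ∈ SW, ∀ (t0 : ℝ) (x0 : Stt n) (u : ℝ → Stt m) (T : EReal) (x : ℝ → Stt n),
      0 ≤ t0 → IsInput u → IsMaxSolution σ.γ (swF F σ) (swG G σ) t0 x0 u T x →
      ∀ t : ℝ, t0 ≤ t → (t : EReal) < T →
        h t (x t) ≤ β (h0 t0 x0) (t - t0) + ρ (inputNorm σ.γ u (Set.Ioc t0 t))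

/-- Strong `(h⁰,h)`-ISS of the family `{Σ_σ}_{σ ∈ SW}`. -/
def SwStronglyISS {n m : ℕ} {Ic Id : Type*} (F : Ic → ℝ → Stt n → Stt m → Stt n)
    (G : Id → ℝ → Stt n → Stt m → Stt n) (SW : Set (SwSignal Ic Id))
    (h0 h : ℝ → Stt n → ℝ) : Prop :=
  ∃ β : ℝ → ℝ → ℝ, ∃ ρ : ℝ → ℝ, ClassKL β ∧ ClassKInf ρ ∧
    ∀ σ ∈ SW, ∀ (t0 : ℝ) (x0 : Stt n) (u : ℝ → Stt m) (T : EReal) (x : ℝ → Stt n),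
      0 ≤ t0 → IsInput u → IsMaxSolution σ.γ (swF F σ) (swG G σ) t0 x0 u T x →
      ∀ t : ℝ, t0 ≤ t → (t : EReal) < T →
        h t (x t) ≤ β (h0 t0 x0) (t - t0 + (nJumps σ.γ t0 t : ℝ)) +
          ρ (inputNorm σ.γ u (Set.Ioc t0 t))

/-- Total activation time in `(t0,t]` of the flow modes in `A`. -/
def actT {Ic Id : Type*} (σ : SwSignal Ic Id) (A : Set Ic) (t0 t : ℝ) : ℝ :=
  (MeasureTheory.volume {r : ℝ | r ∈ Set.Ioc t0 t ∧ σ.σ1 r ∈ A}).toReal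

/-- Number of impulse times in `(t0,t]` whose mode combination lies in `Jp`. -/
def nJumpsIn {Ic Id : Type*} (σ : SwSignal Ic Id) (Jp : Set (Ic × Ic × Id))
    (t0 t : ℝ) : ℕ :=
  (σ.γ ∩ Set.Ioc t0 t ∩ {r : ℝ | (σ.σ1m r, σ.σ1 r, σ.σ2 r) ∈ Jp}).ncard

/-- Assumption 2 of the paper (for switched impulsive systems), data explicit. -/
def Assumption2 {n m : ℕ} {Ic Id : Type*}
    (F : Ic → ℝ → Stt n → Stt m → Stt n) (G : Id → ℝ → Stt n → Stt m → Stt n)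
    (h0 h : ℝ → Stt n → ℝ) (J : Set (Ic × Ic × Id))
    (v : Ic → ℝ → Stt n → ℝ) (φ1 φ2 χ π : ℝ → ℝ)
    (vφ : Ic → ℝ → ℝ → ℝ) (al : Ic × Ic × Id → ℝ → ℝ → ℝ) : Prop :=
  ClassKInf φ1 ∧ ClassKInf φ2 ∧ ClassKInf χ ∧ ClassKInf π ∧
  (∀ i : Ic, LocLipschitzOn ((Set.Ici (0 : ℝ)) ×ˢ (Set.univ : Set (Stt n)))
      (fun q : ℝ × Stt n => v i q.1 q.2)) ∧
  (∀ i : Ic, Caratheodory2 (vφ i)) ∧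
  (∀ e ∈ J, ∀ t r : ℝ, 0 ≤ t → 0 ≤ r → 0 ≤ al e t r) ∧
  (∀ (i : Ic) (t : ℝ) (ξ : Stt n), 0 ≤ t →
    φ1 (h t ξ) ≤ v i t ξ ∧ v i t ξ ≤ φ2 (h0 t ξ)) ∧
  (∀ (i : Ic) (t : ℝ) (ξ : Stt n) (μ : Stt m), 0 ≤ t → χ ‖μ‖ ≤ v i t ξ →
    DiniAlong (F i) (v i) t ξ μ ≤ - vφ i t (v i t ξ)) ∧
  (∀ (ι i : Ic) (j : Id), (ι, i, j) ∈ J → ∀ (t : ℝ) (ξ : Stt n) (μ : Stt m),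
    0 ≤ t → χ ‖μ‖ ≤ v ι t ξ → v i t (ξ + G j t ξ μ) ≤ al (ι, i, j) t (v ι t ξ)) ∧
  (∀ (ι i : Ic) (j : Id), (ι, i, j) ∈ J → ∀ (t : ℝ) (ξ : Stt n) (μ : Stt m),
    0 ≤ t → v ι t ξ ≤ χ ‖μ‖ → v i t (ξ + G j t ξ μ) ≤ π ‖μ‖)

lemma AbsolutelyContinuousOnInterval.of_dist_le {X : Type*} [PseudoMetricSpace X]
    {f : ℝ → X} {N : ℝ → ℝ} {a b K : ℝ} (hK : 0 ≤ K)
    (hN : AbsolutelyContinuousOnInterval N a b)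
    (hf : ∀ s ∈ uIcc a b, ∀ t ∈ uIcc a b, dist (f s) (f t) ≤ K * dist (N s) (N t)) :
    AbsolutelyContinuousOnInterval f a b := by
  rw [absolutelyContinuousOnInterval_iff] at hN ⊢
  intro ε hε
  obtain ⟨δ, hδ, h⟩ := hN (ε / (K + 1)) (by positivity)
  refine ⟨δ, hδ, fun E hE hEδ => ?_⟩
  have h1 := h E hE hEδ
  calc ∑ i ∈ Finset.range E.1, dist (f (E.2 i).1) (f (E.2 i).2)
      ≤ ∑ i ∈ Finset.range E.1, K * dist (N (E.2 i).1) (N (E.2 i).2) :=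
        Finset.sum_le_sum fun i hi => hf _ (hE.1 i hi).1 _ (hE.1 i hi).2
    _ = K * ∑ i ∈ Finset.range E.1, dist (N (E.2 i).1) (N (E.2 i).2) :=
        (Finset.mul_sum _ _ _).symm
    _ ≤ K * (ε / (K + 1)) := by gcongr
    _ < (K + 1) * (ε / (K + 1)) := by gcongr; linarith
    _ = ε := by field

/-- Grönwall's inequality for absolutely continuous functions. -/
lemma AbsolutelyContinuousOnInterval.le_exp_mul {W : ℝ → ℝ} {a b k : ℝ} (hab : a ≤ b)
    (hW : AbsolutelyContinuousOnInterval W a b)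
    (hd : ∀ᵐ s, s ∈ Ioo a b → ∀ w, HasDerivAt W w s → w ≤ k * W s) :
    W b ≤ Real.exp (k * (b - a)) * W a := by
  have hexp : AbsolutelyContinuousOnInterval (fun s => Real.exp (-k * s)) a b := by
    apply ContDiffOn.absolutelyContinuousOnInterval
    fun_prop
  have hE : AbsolutelyContinuousOnInterval (fun s => Real.exp (-k * s) * W s) a b :=
    hexp.mul hW
  have hint := hE.integral_deriv_eq_sub
  have hle : ∫ s in a..b, deriv (fun s => Real.exp (-k * s) * W s) s ≤ ∫ _ in a..b, (0 : ℝ) := by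
    refine intervalIntegral.integral_mono_ae_restrict hab hE.intervalIntegrable_deriv
      intervalIntegrable_const ?_
    rw [EventuallyLE, ae_restrict_iff' measurableSet_Icc]
    have ha : ∀ᵐ s : ℝ, s ≠ a := by simp [ae_iff, measure_singleton]
    have hb : ∀ᵐ s : ℝ, s ≠ b := by simp [ae_iff, measure_singleton]
    filter_upwards [hd, hW.ae_differentiableAt, ha, hb] with s h1 h2 h3 h4 hs
    have hWs := (h2 (by rwa [uIcc_of_le hab])).hasDerivAt
    have hle := h1 ⟨lt_of_le_of_ne hs.1 (Ne.symm h3), lt_of_le_of_ne hs.2 h4⟩ _ hWs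
    have hes : HasDerivAt (fun s => Real.exp (-k * s)) (Real.exp (-k * s) * -k) s := by
      simpa using ((hasDerivAt_id s).const_mul (-k)).exp
    rw [show deriv (fun s => Real.exp (-k * s) * W s) s = _ from (hes.mul hWs).deriv]
    have := mul_le_mul_of_nonneg_left hle (Real.exp_pos (-k * s)).le
    linarith
  simp only [intervalIntegral.integral_zero] at hle
  have h1 : Real.exp (-k * b) * W b ≤ Real.exp (-k * a) * W a := by linarith
  have h2 := mul_le_mul_of_nonneg_left h1 (Real.exp_pos (k * b)).le
  rw [← mul_assoc, ← mul_assoc, ← Real.exp_add, ← Real.exp_add] at h2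
  rw [show k * b + -k * b = 0 by ring, show k * b + -k * a = k * (b - a) by ring] at h2
  simpa using h2

section FlowDerivative

variable {n : ℕ} {V : ℝ → Stt n → ℝ}

lemma continuousOn_of_locLipschitzOn
    (hV : LocLipschitzOn (Ici (0 : ℝ) ×ˢ (univ : Set (Stt n))) fun q : ℝ × Stt n => V q.1 q.2) :
    ContinuousOn (fun q : ℝ × Stt n => V q.1 q.2) (Ici (0 : ℝ) ×ˢ (univ : Set (Stt n))) :=
  LocallyLipschitzOn.continuousOn fun x hx => hV x hx

/-- A locally Lipschitz function is absolutely continuous along a Carathéodory trajectory. -/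
lemma absolutelyContinuousOnInterval_comp_trajectory
    (hV : LocLipschitzOn (Ici (0 : ℝ) ×ˢ (univ : Set (Stt n))) fun q : ℝ × Stt n => V q.1 q.2)
    {x F : ℝ → Stt n} {a b : ℝ} (ha : 0 ≤ a) (hab : a ≤ b) (hF : IntegrableOn F (Icc a b))
    (hx : ∀ t ∈ Icc a b, x t = x a + ∫ s in a..t, F s) :
    AbsolutelyContinuousOnInterval (fun s => V s (x s)) a b := by
  have hFi : IntervalIntegrable F volume a b := by
    rw [intervalIntegrable_iff_integrableOn_Icc_of_le hab]; exact hF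
  have hsub : ∀ s ∈ Icc a b, ∀ t ∈ Icc a b, IntervalIntegrable F volume s t := by
    intro s hs t ht
    exact hFi.mono_set (by rw [uIcc_of_le hab]; exact uIcc_subset_Icc hs ht)
  have hdiff : ∀ s ∈ Icc a b, ∀ t ∈ Icc a b, x t - x s = ∫ r in s..t, F r := by
    intro s hs t ht
    have ha' : a ∈ Icc a b := left_mem_Icc.2 hab
    rw [hx t ht, hx s hs, add_sub_add_left_eq_sub,
      intervalIntegral.integral_interval_sub_left (hsub a ha' t ht) (hsub a ha' s hs)]
  set N : ℝ → ℝ := fun t => ∫ r in a..t, (‖F r‖ + 1) with hNdef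
  have hNi : IntervalIntegrable (fun r => ‖F r‖ + 1) volume a b :=
    hFi.norm.add intervalIntegrable_const
  have hN : AbsolutelyContinuousOnInterval N a b :=
    hNi.absolutelyContinuousOnInterval_intervalIntegral (by simp)
  have hcurve : ∀ s ∈ Icc a b, ∀ t ∈ Icc a b,
      dist ((s, x s) : ℝ × Stt n) (t, x t) ≤ dist (N s) (N t) := by
    have key : ∀ s ∈ Icc a b, ∀ t ∈ Icc a b, s ≤ t →
        dist ((s, x s) : ℝ × Stt n) (t, x t) ≤ dist (N s) (N t) := by
      intro s hs t ht hst
      have ha' : a ∈ Icc a b := left_mem_Icc.2 hab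
      have hN' : N t - N s = (∫ r in s..t, ‖F r‖) + (t - s) := by
        simp only [hNdef]
        rw [intervalIntegral.integral_interval_sub_left
          ((hsub a ha' t ht).norm.add intervalIntegrable_const)
          ((hsub a ha' s hs).norm.add intervalIntegrable_const),
          intervalIntegral.integral_add (hsub s hs t ht).norm intervalIntegrable_const]
        simp
      have hpos : 0 ≤ ∫ r in s..t, ‖F r‖ :=
        intervalIntegral.integral_nonneg hst fun _ _ => norm_nonneg _
      have hnorm := intervalIntegral.norm_integral_le_integral_norm (f := F) (μ := volume) hst
      rw [← hdiff s hs t ht] at hnorm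
      rw [Prod.dist_eq, dist_comm (N s), Real.dist_eq (N t), hN', abs_of_nonneg (by linarith)]
      refine max_le ?_ ?_
      · rw [dist_comm, Real.dist_eq, abs_of_nonneg (by linarith)]; linarith
      · rw [dist_comm, dist_eq_norm]; linarith
    intro s hs t ht
    rcases le_total s t with hst | hst
    · exact key s hs t ht hst
    · rw [dist_comm, dist_comm (N s)]; exact key t ht s hs hst
  have hcont : ContinuousOn (fun s => ((s, x s) : ℝ × Stt n)) (Icc a b) := by
    have : AbsolutelyContinuousOnInterval (fun s => ((s, x s) : ℝ × Stt n)) a b :=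
      .of_dist_le zero_le_one hN (by simpa [uIcc_of_le hab] using hcurve)
    simpa [uIcc_of_le hab] using this.continuousOn
  have hK := isCompact_Icc.image_of_continuousOn hcont
  set S := (fun s => ((s, x s) : ℝ × Stt n)) '' Icc a b
  have hS : S ⊆ Ici (0 : ℝ) ×ˢ (univ : Set (Stt n)) := by
    rintro _ ⟨s, hs, rfl⟩
    exact ⟨ha.trans hs.1, mem_univ _⟩
  have hlip : LocallyLipschitzOn S fun q : ℝ × Stt n => V q.1 q.2 :=
    LocallyLipschitzOn.mono (fun q hq => hV q hq) hS
  obtain ⟨K, hKlip⟩ := hlip.exists_lipschitzOnWith_of_compact hK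
  refine .of_dist_le K.2 hN ?_
  rw [uIcc_of_le hab]
  intro s hs t ht
  exact (hKlip.dist_le_mul _ (mem_image_of_mem _ hs) _ (mem_image_of_mem _ ht)).trans
    (mul_le_mul_of_nonneg_left (hcurve s hs t ht) K.2)

/-- Along a differentiable trajectory the Dini derivative is the derivative of `V s (x s)`. -/
lemma diniAlong_eq_of_hasDerivAt {m : ℕ}
    (hV : LocLipschitzOn (Ici (0 : ℝ) ×ˢ (univ : Set (Stt n))) fun q : ℝ × Stt n => V q.1 q.2)
    {f : ℝ → Stt n → Stt m → Stt n} {x : ℝ → Stt n} {s w : ℝ} {μ : Stt m} (hs : 0 ≤ s)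
    (hx : HasDerivAt x (f s (x s) μ) s) (hw : HasDerivAt (fun r => V r (x r)) w s) :
    DiniAlong f V s (x s) μ = w := by
  set y := f s (x s) μ
  obtain ⟨K, U, hU, hK⟩ := hV (s, x s) ⟨hs, mem_univ _⟩
  have hshift : Tendsto (fun d : ℝ => s + d) (nhdsWithin 0 (Ioi 0)) (nhds s) := by
    have : Tendsto (fun d : ℝ => s + d) (nhds 0) (nhds (s + 0)) :=
      (continuous_const.add continuous_id).tendsto 0
    rw [add_zero] at this
    exact this.mono_left nhdsWithin_le_nhds
  have hmem : ∀ z : ℝ → Stt n, Tendsto z (nhdsWithin 0 (Ioi 0)) (nhds (x s)) →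
      ∀ᶠ d in nhdsWithin (0 : ℝ) (Ioi 0), (s + d, z d) ∈ U := by
    intro z hz
    have h1 : Tendsto (fun d : ℝ => ((s + d, z d) : ℝ × Stt n)) (nhdsWithin 0 (Ioi 0))
        (nhdsWithin (s, x s) (Ici (0 : ℝ) ×ˢ (univ : Set (Stt n)))) := by
      refine tendsto_nhdsWithin_iff.2 ⟨hshift.prodMk_nhds hz, ?_⟩
      filter_upwards [self_mem_nhdsWithin] with d hd
      exact ⟨add_nonneg hs (le_of_lt hd), mem_univ _⟩
    exact h1 hU
  have hx1 : Tendsto (fun d => x (s + d)) (nhdsWithin 0 (Ioi 0)) (nhds (x s)) :=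
    hx.continuousAt.tendsto.comp hshift
  have hx2 : Tendsto (fun d : ℝ => x s + d • y) (nhdsWithin 0 (Ioi 0)) (nhds (x s)) := by
    have : Tendsto (fun d : ℝ => x s + d • y) (nhds 0) (nhds (x s + (0 : ℝ) • y)) :=
      (by fun_prop : Continuous fun d : ℝ => x s + d • y).tendsto 0
    rw [zero_smul, add_zero] at this
    exact this.mono_left nhdsWithin_le_nhds
  have hle : nhdsWithin (0 : ℝ) (Ioi 0) ≤ nhdsWithin 0 {0}ᶜ :=
    nhdsWithin_mono _ fun d hd => ne_of_gt hd
  have hslope := (hasDerivAt_iff_tendsto_slope_zero.1 hw).mono_left hle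
  have hslopex := (hasDerivAt_iff_tendsto_slope_zero.1 hx).mono_left hle
  have hzero : Tendsto (fun d : ℝ => K * ‖d⁻¹ • (x (s + d) - x s) - y‖)
      (nhdsWithin 0 (Ioi 0)) (nhds 0) := by
    simpa using ((hslopex.sub_const y).norm).const_mul (K : ℝ)
  have herr : Tendsto (fun d : ℝ => (V (s + d) (x s + d • y) - V (s + d) (x (s + d))) / d)
      (nhdsWithin 0 (Ioi 0)) (nhds 0) := by
    refine squeeze_zero_norm' ?_ hzero
    filter_upwards [hmem _ hx1, hmem _ hx2, self_mem_nhdsWithin] with d h1 h2 hd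
    have hd : 0 < d := hd
    have h3 := hK.dist_le_mul _ h2 _ h1
    rw [Prod.dist_eq, dist_self, max_eq_right dist_nonneg, Real.dist_eq] at h3
    rw [norm_div, Real.norm_eq_abs, Real.norm_eq_abs, abs_of_pos hd, div_le_iff₀ hd]
    refine h3.trans_eq ?_
    have : d⁻¹ • (x (s + d) - x s) - y = d⁻¹ • (x (s + d) - (x s + d • y)) := by
      rw [← sub_sub, smul_sub d⁻¹ _ (d • y), inv_smul_smul₀ hd.ne']
    rw [this, norm_smul, norm_inv, Real.norm_eq_abs, abs_of_pos hd, dist_comm, dist_eq_norm]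
    field_simp
  have htot : Tendsto (fun d : ℝ => (V (s + d) (x s + d • y) - V s (x s)) / d)
      (nhdsWithin 0 (Ioi 0)) (nhds w) := by
    have := herr.add hslope
    rw [zero_add] at this
    refine this.congr fun d => ?_
    rw [smul_eq_mul]
    ring
  exact htot.limsup_eq

/-- Exponential bound of a Lyapunov function along a trajectory, from a bound on its Dini
derivative that holds for almost every time. -/
lemma le_exp_mul_of_diniAlong_le {m : ℕ}
    (hV : LocLipschitzOn (Ici (0 : ℝ) ×ˢ (univ : Set (Stt n))) fun q : ℝ × Stt n => V q.1 q.2)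
    {f : ℝ → Stt n → Stt m → Stt n} {x : ℝ → Stt n} {u : ℝ → Stt m} {a b k : ℝ}
    (ha : 0 ≤ a) (hab : a ≤ b) (hF : IntegrableOn (fun s => f s (x s) (u s)) (Icc a b))
    (hx : ∀ t ∈ Icc a b, x t = x a + ∫ s in a..t, f s (x s) (u s))
    (hd : ∀ᵐ s, s ∈ Ioo a b → DiniAlong f V s (x s) (u s) ≤ k * V s (x s)) :
    V b (x b) ≤ Real.exp (k * (b - a)) * V a (x a) := by
  refine AbsolutelyContinuousOnInterval.le_exp_mul (W := fun s => V s (x s)) hab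
    (absolutelyContinuousOnInterval_comp_trajectory hV ha hab hF hx) ?_
  have hFi : IntervalIntegrable (fun s => f s (x s) (u s)) volume a b := by
    rw [intervalIntegrable_iff_integrableOn_Icc_of_le hab]; exact hF
  filter_upwards [hd, hFi.ae_hasDerivAt_integral] with s h1 h2 hs w hw
  have hsI : s ∈ uIcc a b := by rw [uIcc_of_le hab]; exact Ioo_subset_Icc_self hs
  have hx' : HasDerivAt x (f s (x s) (u s)) s := by
    refine ((h2 hsI a left_mem_uIcc).const_add (x a)).congr_of_eventuallyEq ?_
    filter_upwards [Icc_mem_nhds hs.1 hs.2] with t ht using hx t ht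
  rw [← diniAlong_eq_of_hasDerivAt hV (ha.trans hs.1.le) hx' hw]
  exact h1 hs

end FlowDerivative

lemma ClassKInf.mono {α : ℝ → ℝ} (hα : ClassKInf α) {r s : ℝ} (hr : 0 ≤ r) (hrs : r ≤ s) :
    α r ≤ α s :=
  hα.2.1.monotoneOn (mem_Ici.2 hr) (mem_Ici.2 (hr.trans hrs)) hrs

lemma ClassKInf.nonneg {α : ℝ → ℝ} (hα : ClassKInf α) {r : ℝ} (hr : 0 ≤ r) : 0 ≤ α r :=
  hα.2.2.1 ▸ hα.mono le_rfl hr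

/-- A class `K∞` function has an inverse on `[0,∞)` that extends to an order isomorphism of `ℝ`. -/
lemma ClassKInf.exists_orderIso {α : ℝ → ℝ} (hα : ClassKInf α) :
    ∃ e : ℝ ≃o ℝ, e 0 = 0 ∧ ∀ r, 0 ≤ r → e r = α r := by
  set g : ℝ → ℝ := fun r => if 0 ≤ r then α r else r with hg
  have hpos : ∀ r, 0 ≤ r → g r = α r := fun r hr => if_pos hr
  have hneg : ∀ r, r < 0 → g r = r := fun r hr => if_neg (not_le.2 hr)
  have hmono : StrictMono g := by
    intro r s hrs
    rcases le_or_gt 0 r with hr | hr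
    · rw [hpos r hr, hpos s (hr.trans hrs.le)]
      exact hα.2.1 hr (hr.trans hrs.le) hrs
    · rw [hneg r hr]
      rcases le_or_gt 0 s with hs | hs
      · rw [hpos s hs]; exact hr.trans_le (hα.nonneg hs)
      · rwa [hneg s hs]
  have hsurj : Function.Surjective g := by
    intro y
    rcases lt_or_ge y 0 with hy | hy
    · exact ⟨y, hneg y hy⟩
    · obtain ⟨r, hr, hyr⟩ := hα.2.2.2 y
      obtain ⟨s, hs, hsy⟩ := intermediate_value_Icc hr
        (hα.1.mono Icc_subset_Ici_self) ⟨hα.2.2.1.symm ▸ hy, hyr⟩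
      exact ⟨s, (hpos s hs.1).trans hsy⟩
  refine ⟨hmono.orderIsoOfSurjective g hsurj, ?_, fun r hr => ?_⟩
  · simp [hg, hα.2.2.1]
  · simp [hg, hr]

/-- `ψ ∘ α` is of class `K∞` when `ψ` is an order isomorphism fixing `0`. -/
lemma ClassKInf.orderIso_comp {α : ℝ → ℝ} (hα : ClassKInf α) (e : ℝ ≃o ℝ) (he : e 0 = 0) :
    ClassKInf fun r => e (α r) := by
  refine ⟨e.continuous.comp_continuousOn hα.1, fun r hr s hs hrs => e.strictMono (hα.2.1 hr hs hrs),
    by simp [hα.2.2.1, he], fun M => ?_⟩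
  obtain ⟨r, hr, hM⟩ := hα.2.2.2 (e.symm M)
  exact ⟨r, hr, by simpa using e.monotone hM⟩

lemma ClassKInf.const_mul {α : ℝ → ℝ} (hα : ClassKInf α) {c : ℝ} (hc : 0 < c) :
    ClassKInf fun r => c * α r := by
  refine ⟨hα.1.const_smul c, fun r hr s hs hrs => mul_lt_mul_of_pos_left (hα.2.1 hr hs hrs) hc,
    by simp [hα.2.2.1], fun M => ?_⟩
  obtain ⟨r, hr, hM⟩ := hα.2.2.2 (M / c)
  exact ⟨r, hr, by rwa [div_le_iff₀' hc] at hM⟩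

lemma ClassKInf.max {α α' : ℝ → ℝ} (hα : ClassKInf α) (hα' : ClassKInf α') :
    ClassKInf fun r => max (α r) (α' r) := by
  refine ⟨hα.1.sup hα'.1, fun r hr s hs hrs => max_lt_max (hα.2.1 hr hs hrs) (hα'.2.1 hr hs hrs),
    by simp [hα.2.2.1, hα'.2.2.1], fun M => ?_⟩
  obtain ⟨r, hr, hM⟩ := hα.2.2.2 M
  exact ⟨r, hr, hM.trans (le_max_left _ _)⟩

/-- The `KL` function obtained by exponential decay in transformed coordinates. -/
lemma classKL_orderIso_exp {α : ℝ → ℝ} (hα : ClassKInf α) (e : ℝ ≃o ℝ) (he : e 0 = 0)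
    {μ η : ℝ} (hη : 0 < η) :
    ClassKL fun r t => e (Real.exp (μ - η * t) * α r) := by
  refine ⟨fun t _ => (hα.const_mul (Real.exp_pos _)).orderIso_comp e he, fun r hr => ⟨?_, ?_⟩⟩
  · intro s _ t _ hst
    have := hα.nonneg hr
    refine e.monotone ?_
    gcongr
  · have h1 : Tendsto (fun t : ℝ => Real.exp (μ - η * t)) atTop (nhds 0) := by
      refine Real.tendsto_exp_atBot.comp ?_
      exact tendsto_atBot_add_const_left _ μ
        (tendsto_neg_atTop_atBot.comp (tendsto_id.const_mul_atTop hη))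
    have h2 := (e.continuous.tendsto _).comp (h1.mul_const (α r))
    rwa [zero_mul, he] at h2

section InputNorm

variable {m : ℕ} {γ : Set ℝ} {u : ℝ → Stt m}

lemma inputNorm_nonneg (γ : Set ℝ) (u : ℝ → Stt m) (I : Set ℝ) : 0 ≤ inputNorm γ u I :=
  le_max_of_le_right <| Real.sSup_nonneg <| by rintro _ ⟨s, -, rfl⟩; exact norm_nonneg _

lemma norm_le_inputNorm_of_mem (hγ : IsImpulseSeq γ) {s t r : ℝ} (hr : r ∈ γ ∩ Ioc s t) :
    ‖u r‖ ≤ inputNorm γ u (Ioc s t) := by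
  have hfin : (γ ∩ Ioc s t).Finite := (hγ.2 t).subset fun q hq => ⟨hq.1, hq.2.2⟩
  exact le_max_of_le_right (le_csSup (hfin.image _).bddAbove (mem_image_of_mem _ hr))

lemma ae_norm_le_inputNorm (hu : IsInput u) {s t : ℝ} (hs : 0 ≤ s) :
    ∀ᵐ r, r ∈ Ioc s t → ‖u r‖ ≤ inputNorm γ u (Ioc s t) := by
  obtain ⟨C, hC⟩ := hu.2 t
  rw [← ae_restrict_iff' measurableSet_Ioc]
  have hbdd : IsBoundedUnder (· ≤ ·) (ae (volume.restrict (Ioc s t))) fun r => ‖u r‖ := by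
    refine ⟨C, ?_⟩
    rw [eventually_map, ae_restrict_iff' measurableSet_Ioc]
    filter_upwards [hC] with r hr hrI using hr ⟨hs.trans hrI.1.le, hrI.2⟩
  filter_upwards [ae_le_essSup hbdd] with r hr using hr.trans (le_max_left _ _)

end InputNorm

section Growth

variable {Ic Id : Type*} (σ : SwSignal Ic Id)

lemma SwSignal.finite_inter_Ioc (s t : ℝ) : (σ.γ ∩ Ioc s t).Finite :=
  (σ.impulse.2 t).subset fun _ hq => ⟨hq.1, hq.2.2⟩

lemma nJumpsIn_add (A : Set (Ic × Ic × Id)) {s r t : ℝ} (hsr : s ≤ r) (hrt : r ≤ t) :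
    nJumpsIn σ A s t = nJumpsIn σ A s r + nJumpsIn σ A r t := by
  rw [nJumpsIn, ← Ioc_union_Ioc_eq_Ioc hsr hrt, inter_union_distrib_left, union_inter_distrib_right,
    ncard_union_eq _ ((σ.finite_inter_Ioc s r).inter_of_left _)
      ((σ.finite_inter_Ioc r t).inter_of_left _)]
  · rfl
  · refine Set.disjoint_left.2 fun q h1 h2 => ?_
    exact absurd h1.1.2.2 (not_le.2 h2.1.2.1)

lemma actT_add (A : Set Ic) {s r t : ℝ} (hsr : s ≤ r) (hrt : r ≤ t) :
    actT σ A s t = actT σ A s r + actT σ A r t := by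
  have hfin : ∀ a b : ℝ, volume {q : ℝ | q ∈ Ioc a b ∧ σ.σ1 q ∈ A} ≠ ⊤ := fun a b =>
    ne_top_of_le_ne_top (by simp) (measure_mono (t := Ioc a b) fun q hq => hq.1)
  rw [actT, actT, actT, ← ENNReal.toReal_add (hfin s r) (hfin r t),
    ← measure_inter_add_sdiff {q : ℝ | q ∈ Ioc s t ∧ σ.σ1 q ∈ A} (measurableSet_Iic (a := r))]
  congr 3
  · ext q
    simp only [mem_inter_iff, mem_ofPred_eq, mem_Ioc, mem_Iic]
    exact ⟨fun hq => ⟨⟨hq.1.1.1, hq.2⟩, hq.1.2⟩,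
      fun hq => ⟨⟨⟨hq.1.1, hq.1.2.trans hrt⟩, hq.2⟩, hq.1.2⟩⟩
  · ext q
    simp only [Set.mem_sdiff, mem_ofPred_eq, mem_Ioc, mem_Iic, not_le]
    exact ⟨fun hq => ⟨⟨hq.2, hq.1.1.2⟩, hq.1.2⟩,
      fun hq => ⟨⟨⟨hsr.trans_lt hq.1.1, hq.1.2⟩, hq.2⟩, hq.1.1⟩⟩

/-- The activation time of a mode that is constant on `[a,b)`. -/
lemma actT_of_const (A : Set Ic) {a b : ℝ} (hab : a ≤ b) {i : Ic}
    (hi : ∀ r ∈ Ico a b, σ.σ1 r = i) : actT σ A a b = if i ∈ A then b - a else 0 := by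
  have hae : {r : ℝ | r ∈ Ioc a b ∧ σ.σ1 r ∈ A} =ᵐ[volume] (if i ∈ A then Ioc a b else ∅ : Set ℝ) := by
    have hb : ∀ᵐ s : ℝ, s ≠ b := by simp [ae_iff, measure_singleton]
    rw [eventuallyEq_set]
    filter_upwards [hb] with r hr
    have hmem : r ∈ Ioc a b → σ.σ1 r = i := fun h => hi r ⟨h.1.le, lt_of_le_of_ne h.2 hr⟩
    split_ifs with hiA
    · exact ⟨fun h => h.1, fun h => ⟨h, (hmem h).symm ▸ hiA⟩⟩
    · exact ⟨fun h => hiA (hmem h.1 ▸ h.2), fun h => h.elim⟩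
  rw [actT, measure_congr hae]
  split_ifs <;> simp [hab]

/-- The factor by which a Lyapunov function may grow over `(s,t]` along the comparison dynamics
with exponential rates `-cs, 0, cu` and jump gains `ds, 1, du`. -/
def growthFactor (Ics Icu : Set Ic) (Js Ju : Set (Ic × Ic × Id)) (cs cu ds du : ℝ)
    (s t : ℝ) : ℝ :=
  ds ^ nJumpsIn σ Js s t * du ^ nJumpsIn σ Ju s t *
    Real.exp (cu * actT σ Icu s t - cs * actT σ Ics s t)

variable {Ics Icn Icu : Set Ic} {Js Jn Ju : Set (Ic × Ic × Id)} {cs cu ds du : ℝ}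

lemma growthFactor_nonneg (hds : 0 ≤ ds) (hdu : 0 ≤ du) (s t : ℝ) :
    0 ≤ growthFactor σ Ics Icu Js Ju cs cu ds du s t := by
  unfold growthFactor; positivity

lemma growthFactor_self (s : ℝ) : growthFactor σ Ics Icu Js Ju cs cu ds du s s = 1 := by
  simp [growthFactor, nJumpsIn, actT]

lemma growthFactor_mul {s r t : ℝ} (hsr : s ≤ r) (hrt : r ≤ t) :
    growthFactor σ Ics Icu Js Ju cs cu ds du r t * growthFactor σ Ics Icu Js Ju cs cu ds du s r =
      growthFactor σ Ics Icu Js Ju cs cu ds du s t := by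
  simp only [growthFactor, nJumpsIn_add σ _ hsr hrt, actT_add σ _ hsr hrt, pow_add]
  rw [show cu * (actT σ Icu s r + actT σ Icu r t) - cs * (actT σ Ics s r + actT σ Ics r t) =
    (cu * actT σ Icu s r - cs * actT σ Ics s r) + (cu * actT σ Icu r t - cs * actT σ Ics r t) by
    ring, Real.exp_add]
  ring

lemma growthFactor_le_exp (hds : 0 ≤ ds) (hdu : 0 < du) {s t B : ℝ}
    (h : (0 < ds ∨ nJumpsIn σ Js s t = 0) →
      (nJumpsIn σ Js s t : ℝ) * Real.log ds + (nJumpsIn σ Ju s t : ℝ) * Real.log du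
        - cs * actT σ Ics s t + cu * actT σ Icu s t ≤ B) :
    growthFactor σ Ics Icu Js Ju cs cu ds du s t ≤ Real.exp B := by
  by_cases hc : 0 < ds ∨ nJumpsIn σ Js s t = 0
  · have h1 : ds ^ nJumpsIn σ Js s t = Real.exp ((nJumpsIn σ Js s t : ℝ) * Real.log ds) := by
      rcases hc with hc | hc
      · rw [Real.exp_nat_mul, Real.exp_log hc]
      · simp [hc]
    have h2 : du ^ nJumpsIn σ Ju s t = Real.exp ((nJumpsIn σ Ju s t : ℝ) * Real.log du) := by
      rw [Real.exp_nat_mul, Real.exp_log hdu]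
    rw [growthFactor, h1, h2, ← Real.exp_add, ← Real.exp_add]
    exact Real.exp_le_exp.2 (by linarith [h hc])
  · push Not at hc
    have : ds = 0 := le_antisymm hc.1 hds
    rw [growthFactor, this, zero_pow hc.2]
    simp [Real.exp_nonneg]

/-- The growth factor over an interval during which the mode does not change. -/
lemma growthFactor_eq_of_const (hIuniv : Ics ∪ Icn ∪ Icu = Set.univ)
    (hIdisj : Disjoint Ics Icn ∧ Disjoint Ics Icu ∧ Disjoint Icn Icu) {a b : ℝ} (hab : a ≤ b)
    {i : Ic} (hi : ∀ r ∈ Ico a b, σ.σ1 r = i) :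
    growthFactor σ Ics Icu Js Ju cs cu ds du a b =
      ds ^ nJumpsIn σ Js a b * du ^ nJumpsIn σ Ju a b *
        Real.exp ((if i ∈ Ics then -cs else if i ∈ Icn then 0 else cu) * (b - a)) := by
  have hmem : (i ∈ Ics ∨ i ∈ Icn) ∨ i ∈ Icu := by
    have : i ∈ Ics ∪ Icn ∪ Icu := hIuniv ▸ mem_univ i
    exact this
  have h1 := fun h : i ∈ Ics => Set.disjoint_left.1 hIdisj.2.1 h
  have h2 := fun h : i ∈ Icn => Set.disjoint_left.1 hIdisj.2.2 h
  rw [growthFactor, actT_of_const σ Icu hab hi, actT_of_const σ Ics hab hi]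
  congr 2
  by_cases hs : i ∈ Ics
  · simp [hs, h1 hs]
  · by_cases hn : i ∈ Icn
    · simp [hs, hn, h2 hn]
    · have hu : i ∈ Icu := by tauto
      simp [hs, hn, hu]

lemma nJumpsIn_of_Ioc_inter_eq_empty (A : Set (Ic × Ic × Id)) {a b : ℝ}
    (h : Ioc a b ∩ σ.γ = ∅) : nJumpsIn σ A a b = 0 := by
  rw [nJumpsIn, inter_comm σ.γ, h]; simp

lemma nJumpsIn_of_Ioo_inter_eq_empty (A : Set (Ic × Ic × Id)) {a b : ℝ} (hab : a < b)
    (hb : b ∈ σ.γ) (h : Ioo a b ∩ σ.γ = ∅) :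
    nJumpsIn σ A a b = if (σ.σ1m b, σ.σ1 b, σ.σ2 b) ∈ A then 1 else 0 := by
  have h1 : σ.γ ∩ Ioc a b = {b} := by
    rw [← Ioo_union_right hab, inter_union_distrib_left, inter_comm, h, empty_union,
      inter_singleton_of_mem hb]
  rw [nJumpsIn, h1]
  split_ifs with hA
  · rw [inter_eq_left.2 (by simpa using hA), ncard_singleton]
  · rw [show ({b} : Set ℝ) ∩ {r | (σ.σ1m r, σ.σ1 r, σ.σ2 r) ∈ A} = ∅ by simpa using hA,
      ncard_empty]

/-- A transitive relation that holds on all closed intervals without interior impulse times holds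
on every interval. -/
lemma SwSignal.rel_of_trans {S : ℝ → ℝ → Prop} {lo hi : ℝ}
    (htrans : ∀ a b c, lo ≤ a → a ≤ b → b ≤ c → c ≤ hi → S a b → S b c → S a c)
    (hstep : ∀ a b, lo ≤ a → a ≤ b → b ≤ hi → Ioo a b ∩ σ.γ = ∅ → S a b)
    {a b : ℝ} (ha : lo ≤ a) (hab : a ≤ b) (hb : b ≤ hi) : S a b := by
  have hfin : ∀ a b : ℝ, (Ioo a b ∩ σ.γ).Finite := fun a b =>
    (σ.finite_inter_Ioc a b).subset fun q hq => ⟨hq.2, hq.1.1, hq.1.2.le⟩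
  induction hk : (Ioo a b ∩ σ.γ).ncard using Nat.strong_induction_on generalizing a b with
  | _ k ih =>
    rcases (Ioo a b ∩ σ.γ).eq_empty_or_nonempty with he | ⟨r, hr⟩
    · exact hstep a b ha hab hb he
    · have h1 : (Ioo a r ∩ σ.γ).ncard < k := hk ▸ ncard_lt_ncard
        ⟨fun q hq => ⟨⟨hq.1.1, hq.1.2.trans hr.1.2⟩, hq.2⟩,
          fun hsub => (hsub hr).1.2.false⟩ (hfin a b)
      have h2 : (Ioo r b ∩ σ.γ).ncard < k := hk ▸ ncard_lt_ncard
        ⟨fun q hq => ⟨⟨hr.1.1.trans hq.1.1, hq.1.2⟩, hq.2⟩,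
          fun hsub => (hsub hr).1.1.false⟩ (hfin a b)
      exact htrans a r b ha hr.1.1.le hr.1.2.le hb
        (ih _ h1 ha hr.1.1.le (hr.1.2.le.trans hb) rfl)
        (ih _ h2 (ha.trans hr.1.1.le) hr.1.2.le hb rfl)

/-- The first mode is constant on closed intervals without impulse times after the left end. -/
lemma SwSignal.σ1_eq_of_Ioc_inter_eq_empty {a b : ℝ} (ha : 0 ≤ a) (h : Ioc a b ∩ σ.γ = ∅) :
    ∀ r ∈ Icc a b, σ.σ1 r = σ.σ1 a := by
  intro r hr
  have hfin : (Ioc b (b + 1) ∩ σ.γ).Finite := by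
    rw [inter_comm]; exact σ.finite_inter_Ioc b (b + 1)
  have hnhds : (Ioc b (b + 1) ∩ σ.γ)ᶜ ∈ nhds b :=
    hfin.isClosed.isOpen_compl.mem_nhds fun hb => hb.1.1.false
  obtain ⟨ε, hε, hball⟩ := Metric.mem_nhds_iff.1 hnhds
  refine σ.const1 a (b + min ε 1) ha ?_ r ⟨hr.1, by have := lt_min hε one_pos; linarith [hr.2]⟩
  refine eq_empty_iff_forall_notMem.2 fun q hq => ?_
  have hq1 : q < b + ε := hq.1.2.trans_le (by gcongr; exact min_le_left _ _)
  have hq2 : q < b + 1 := hq.1.2.trans_le (by gcongr; exact min_le_right _ _)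
  rcases le_or_gt q b with hqb | hqb
  · exact eq_empty_iff_forall_notMem.1 h q ⟨⟨hq.1.1, hqb⟩, hq.2⟩
  · refine hball ?_ ⟨⟨hqb, hq2.le⟩, hq.2⟩
    rw [Metric.mem_ball, Real.dist_eq, abs_of_pos (by linarith)]
    linarith

lemma SwSignal.σ1m_eq {a b : ℝ} (ha : 0 ≤ a) (hab : a < b) (hb : b ∈ σ.γ)
    (h : Ioo a b ∩ σ.γ = ∅) : σ.σ1m b = σ.σ1 a := by
  have h2 : ∀ᶠ s in nhdsWithin b (Iio b), s ∈ Ioo a b := Ioo_mem_nhdsLT hab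
  obtain ⟨s, hs1, hs2⟩ := ((σ.leftlim b hb).and h2).exists
  rw [← hs1]
  exact σ.const1 a b ha h s ⟨hs2.1.le, hs2.2⟩

end Growth

section Trajectory

variable {n m : ℕ} {Ic Id : Type*} {F : Ic → ℝ → Stt n → Stt m → Stt n}
  {G : Id → ℝ → Stt n → Stt m → Stt n} {σ : SwSignal Ic Id} {v : Ic → ℝ → Stt n → ℝ}
  {t0 : ℝ} {x0 : Stt n} {u : ℝ → Stt m} {T : EReal} {x : ℝ → Stt n}

/-- On an interval without impulses the trajectory solves the integral equation of the mode that
is active at the left end. -/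
lemma IsSolution.integral_eq_of_Ioc_inter_eq_empty
    (hsol : IsSolution σ.γ (swF F σ) (swG G σ) t0 x0 u T x) (ht0 : 0 ≤ t0)
    {a b : ℝ} (ha : t0 ≤ a) (hab : a ≤ b) (hbT : (b : EReal) < T) (hγ : Ioc a b ∩ σ.γ = ∅) :
    IntegrableOn (fun s => F (σ.σ1 a) s (x s) (u s)) (Icc a b) ∧
      ∀ t ∈ Icc a b, x t = x a + ∫ s in a..t, F (σ.σ1 a) s (x s) (u s) := by
  have hmode := σ.σ1_eq_of_Ioc_inter_eq_empty (ht0.trans ha) hγ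
  have hcongr : EqOn (fun s => swF F σ s (x s) (u s)) (fun s => F (σ.σ1 a) s (x s) (u s))
      (Icc a b) := fun s hs => by simp only [swF, hmode s hs]
  refine ⟨(integrableOn_congr_fun hcongr measurableSet_Icc).1
    (hsol.flow a b ha hab hbT hγ).1, fun t ht => ?_⟩
  have hemp : Ioc a t ∩ σ.γ = ∅ :=
    subset_empty_iff.1 (hγ ▸ inter_subset_inter_left _ (Ioc_subset_Ioc_right ht.2))
  rw [(hsol.flow a t ha ht.1 (lt_of_le_of_lt (EReal.coe_le_coe_iff.2 ht.2) hbT) hemp).2]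
  congr 1
  refine intervalIntegral.integral_congr fun s hs => hcongr ?_
  rw [uIcc_of_le ht.1] at hs
  exact ⟨hs.1, hs.2.trans ht.2⟩

variable {χ : ℝ → ℝ} {k : Ic → ℝ} {c : ℝ}

/-- Exponential bound along the flow as long as the Lyapunov function dominates the input. -/
lemma IsSolution.le_exp_mul_of_flow
    (hsol : IsSolution σ.γ (swF F σ) (swG G σ) t0 x0 u T x) (ht0 : 0 ≤ t0)
    (hlip : ∀ i, LocLipschitzOn (Ici (0 : ℝ) ×ˢ (univ : Set (Stt n)))
      fun q : ℝ × Stt n => v i q.1 q.2)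
    (hdini : ∀ i t ξ (μ : Stt m), 0 ≤ t → χ ‖μ‖ ≤ v i t ξ →
      DiniAlong (F i) (v i) t ξ μ ≤ k i * v i t ξ)
    {a b : ℝ} (ha : t0 ≤ a) (hab : a ≤ b) (hbT : (b : EReal) < T) (hγ : Ioc a b ∩ σ.γ = ∅)
    (hu : ∀ᵐ s, s ∈ Ioo a b → χ ‖u s‖ ≤ c) (hc : ∀ s ∈ Ioo a b, c ≤ v (σ.σ1 a) s (x s)) :
    v (σ.σ1 a) b (x b) ≤ Real.exp (k (σ.σ1 a) * (b - a)) * v (σ.σ1 a) a (x a) := by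
  obtain ⟨hint, hx⟩ := hsol.integral_eq_of_Ioc_inter_eq_empty ht0 ha hab hbT hγ
  refine le_exp_mul_of_diniAlong_le (hlip _) (ht0.trans ha) hab hint hx ?_
  filter_upwards [hu] with s hs hsI
  exact hdini _ _ _ _ ((ht0.trans ha).trans hsI.1.le) ((hs hsI).trans (hc s hsI))

/-- The Lyapunov function gains at most the growth factor over `[s,t]`, or it is bounded by
the input level `C` amplified from some intermediate time on. -/
def GrowthBound (W : ℝ → ℝ) (P : ℝ → ℝ → ℝ) (C s t : ℝ) : Prop :=
  W t ≤ P s t * W s ∨ ∃ r ∈ Icc s t, W t ≤ P r t * C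

lemma GrowthBound.trans {W : ℝ → ℝ} {P : ℝ → ℝ → ℝ} {C s r t : ℝ} (hP : ∀ a b, 0 ≤ P a b)
    (hmul : ∀ a b c, a ≤ b → b ≤ c → P b c * P a b = P a c) (hsr : s ≤ r) (hrt : r ≤ t)
    (h1 : GrowthBound W P C s r) (h2 : GrowthBound W P C r t) : GrowthBound W P C s t := by
  rcases h2 with h2 | ⟨q, hq, h2⟩
  · rcases h1 with h1 | ⟨q, hq, h1⟩
    · left
      rw [← hmul s r t hsr hrt, mul_assoc]
      exact h2.trans (mul_le_mul_of_nonneg_left h1 (hP _ _))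
    · refine Or.inr ⟨q, ⟨hq.1, hq.2.trans hrt⟩, ?_⟩
      rw [← hmul q r t hq.2 hrt, mul_assoc]
      exact h2.trans (mul_le_mul_of_nonneg_left h1 (hP _ _))
  · exact Or.inr ⟨q, ⟨hsr.trans hq.1, hq.2⟩, h2⟩

/-- Growth bound along the flow. -/
lemma IsSolution.growthBound_of_flow
    (hsol : IsSolution σ.γ (swF F σ) (swG G σ) t0 x0 u T x) (ht0 : 0 ≤ t0)
    (hlip : ∀ i, LocLipschitzOn (Ici (0 : ℝ) ×ˢ (univ : Set (Stt n)))
      fun q : ℝ × Stt n => v i q.1 q.2)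
    (hdini : ∀ i t ξ (μ : Stt m), 0 ≤ t → χ ‖μ‖ ≤ v i t ξ →
      DiniAlong (F i) (v i) t ξ μ ≤ k i * v i t ξ)
    {P : ℝ → ℝ → ℝ} {C : ℝ} (hcC : c ≤ C)
    {a b : ℝ} (ha : t0 ≤ a) (hab : a ≤ b) (hbT : (b : EReal) < T) (hγ : Ioc a b ∩ σ.γ = ∅)
    (hP : ∀ r ∈ Icc a b, P r b = Real.exp (k (σ.σ1 a) * (b - r)))
    (hu : ∀ᵐ s, s ∈ Ioo a b → χ ‖u s‖ ≤ c) :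
    GrowthBound (fun s => v (σ.σ1 s) s (x s)) P C a b := by
  have hmode := σ.σ1_eq_of_Ioc_inter_eq_empty (ht0.trans ha) hγ
  obtain ⟨hint, hx⟩ := hsol.integral_eq_of_Ioc_inter_eq_empty ht0 ha hab hbT hγ
  set i := σ.σ1 a with hi
  have hcont : ContinuousOn (fun s => v i s (x s)) (Icc a b) := by
    simpa [uIcc_of_le hab] using (absolutelyContinuousOnInterval_comp_trajectory (hlip i)
      (ht0.trans ha) hab hint hx).continuousOn
  have hb : σ.σ1 b = i := hmode b (right_mem_Icc.2 hab)
  have hcompact : IsCompact (Icc a b ∩ (fun s => v i s (x s)) ⁻¹' Iic c) :=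
    isCompact_Icc.of_isClosed_subset (hcont.preimage_isClosed_of_isClosed isClosed_Icc isClosed_Iic)
      inter_subset_left
  rcases (Icc a b ∩ (fun s => v i s (x s)) ⁻¹' Iic c).eq_empty_or_nonempty with he | hne
  · left
    have hc : ∀ s ∈ Icc a b, c < v i s (x s) := fun s hs => by
      by_contra hle
      exact eq_empty_iff_forall_notMem.1 he s ⟨hs, not_lt.1 hle⟩
    simp only [hb, ← hi, hP a (left_mem_Icc.2 hab)]
    exact hsol.le_exp_mul_of_flow ht0 hlip hdini ha hab hbT hγ hu
      fun s hs => (hc s (Ioo_subset_Icc_self hs)).le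
  · obtain ⟨r, ⟨hr, hrc⟩, hmax⟩ := hcompact.exists_isGreatest hne
    have hrc : v i r (x r) ≤ c := hrc
    refine Or.inr ⟨r, hr, ?_⟩
    have hri : σ.σ1 r = i := hmode r hr
    have hflow := hsol.le_exp_mul_of_flow (c := c) ht0 hlip hdini (ha.trans hr.1) hr.2 hbT
      (subset_empty_iff.1 (hγ ▸ inter_subset_inter_left _ (Ioc_subset_Ioc_left hr.1)))
      (by filter_upwards [hu] with s hs hsI using hs ⟨hr.1.trans_lt hsI.1, hsI.2⟩)
      (fun s hs => by
        rw [hri]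
        by_contra hle
        exact absurd (hmax ⟨⟨hr.1.trans hs.1.le, hs.2.le⟩, (not_le.1 hle).le⟩) (not_le.2 hs.1))
    simp only [hb, hP r hr]
    rw [hri] at hflow
    exact hflow.trans (mul_le_mul_of_nonneg_left (hrc.trans hcC) (Real.exp_pos _).le)

/-- Growth bound up to and including an impulse time. -/
lemma IsSolution.growthBound_of_jump
    (hsol : IsSolution σ.γ (swF F σ) (swG G σ) t0 x0 u T x) (ht0 : 0 ≤ t0)
    (hlip : ∀ i, LocLipschitzOn (Ici (0 : ℝ) ×ˢ (univ : Set (Stt n)))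
      fun q : ℝ × Stt n => v i q.1 q.2)
    (hdini : ∀ i t ξ (μ : Stt m), 0 ≤ t → χ ‖μ‖ ≤ v i t ξ →
      DiniAlong (F i) (v i) t ξ μ ≤ k i * v i t ξ)
    {P : ℝ → ℝ → ℝ} {C d : ℝ} (hcC : c ≤ C) (hd : 0 ≤ d) (hP0 : ∀ a b, 0 ≤ P a b)
    (hmul : ∀ a b c, a ≤ b → b ≤ c → P b c * P a b = P a c)
    {a b : ℝ} (ha : t0 ≤ a) (hab : a < b) (hbT : (b : EReal) < T) (hb : b ∈ σ.γ)
    (hγ : Ioo a b ∩ σ.γ = ∅)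
    (hP : ∀ r s, a ≤ r → r ≤ s → s < b → P r s = Real.exp (k (σ.σ1 a) * (s - r)))
    (hPb : ∀ r, a ≤ r → r < b → P r b = d * Real.exp (k (σ.σ1 a) * (b - r)))
    (hPbb : P b b = 1)
    (hu : ∀ᵐ s, s ∈ Ioo a b → χ ‖u s‖ ≤ c)
    (hbig : ∀ ξ, c < v (σ.σ1m b) b ξ →
      v (σ.σ1 b) b (ξ + G (σ.σ2 b) b ξ (u b)) ≤ d * v (σ.σ1m b) b ξ)
    (hsmall : ∀ ξ, v (σ.σ1m b) b ξ ≤ c → v (σ.σ1 b) b (ξ + G (σ.σ2 b) b ξ (u b)) ≤ C) :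
    GrowthBound (fun s => v (σ.σ1 s) s (x s)) P C a b := by
  have ha0 : 0 ≤ a := ht0.trans ha
  have hmode : ∀ r ∈ Ico a b, σ.σ1 r = σ.σ1 a := σ.const1 a b ha0 hγ
  have hm : σ.σ1m b = σ.σ1 a := σ.σ1m_eq ha0 hab hb hγ
  rw [hm] at hbig hsmall
  set i := σ.σ1 a with hi
  obtain ⟨L, hL, hxb⟩ := hsol.jump b hb (ha.trans_lt hab) hbT
  have hxb : x b = L + G (σ.σ2 b) b L (u b) := hxb
  have hemp : ∀ r s, a ≤ r → s < b → Ioc r s ∩ σ.γ = ∅ := fun r s hr hs =>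
    subset_empty_iff.1 <| hγ ▸ inter_subset_inter_left _ fun q hq =>
      ⟨hr.trans_lt hq.1, hq.2.trans_lt hs⟩
  rcases le_or_gt (v i b L) c with hle | hgt
  · refine Or.inr ⟨b, right_mem_Icc.2 hab.le, ?_⟩
    simp only [hPbb, one_mul, hxb]
    exact hsmall L hle
  have hlim : Tendsto (fun s => v i s (x s)) (nhdsWithin b (Iio b)) (nhds (v i b L)) := by
    have hcont := continuousOn_of_locLipschitzOn (hlip i) (b, L) ⟨ha0.trans hab.le, mem_univ _⟩
    refine hcont.tendsto.comp (tendsto_nhdsWithin_iff.2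
      ⟨(tendsto_id.mono_left nhdsWithin_le_nhds).prodMk_nhds hL, ?_⟩)
    filter_upwards [Ioo_mem_nhdsLT hab] with s hs using ⟨ha0.trans hs.1.le, mem_univ _⟩
  obtain ⟨l, hl, hlb⟩ := (mem_nhdsLT_iff_exists_Ioo_subset' hab).1 (hlim.eventually (lt_mem_nhds hgt))
  obtain ⟨e, he, heb⟩ := exists_between (max_lt hab hl)
  have hae : a ≤ e := (le_max_left _ _).trans he.le
  have hle : l < e := (le_max_right _ _).trans_lt he
  have hei : σ.σ1 e = i := hmode e ⟨hae, heb⟩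
  have hT : ∀ s, s < b → (s : EReal) < T := fun s hs => (EReal.coe_lt_coe_iff.2 hs).trans hbT
  have hright : GrowthBound (fun s => v (σ.σ1 s) s (x s)) P C e b := by
    left
    have hbound : v i b L ≤ Real.exp (k i * (b - e)) * v i e (x e) := by
      have hlim' : Tendsto (fun s => Real.exp (k i * (s - e)) * v i e (x e))
          (nhdsWithin b (Iio b)) (nhds (Real.exp (k i * (b - e)) * v i e (x e))) :=
        ((by fun_prop : Continuous fun s => Real.exp (k i * (s - e)) * v i e (x e)).tendsto
          b).mono_left nhdsWithin_le_nhds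
      refine le_of_tendsto_of_tendsto hlim hlim' ?_
      filter_upwards [Ioo_mem_nhdsLT heb] with s hs
      have := hsol.le_exp_mul_of_flow (c := c) ht0 hlip hdini (ha.trans hae) hs.1.le (hT s hs.2)
        (hemp e s hae hs.2)
        (by filter_upwards [hu] with q hq hqI using
          hq ⟨hae.trans_lt hqI.1, hqI.2.trans hs.2⟩)
        (fun q hq => by
          rw [hei]
          exact (hlb ⟨hle.trans hq.1, hq.2.trans hs.2⟩ : c < v i q (x q)).le)
      rwa [hei] at this
    simp only [hxb, hei, hPb e hae heb]
    rw [mul_assoc]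
    exact (hbig L hgt).trans (mul_le_mul_of_nonneg_left hbound hd)
  refine GrowthBound.trans hP0 hmul hae heb.le ?_ hright
  exact hsol.growthBound_of_flow ht0 hlip hdini hcC ha hae (hT e heb) (hemp a e le_rfl heb)
    (fun r hr => hP r e hr.1 hr.2 heb)
    (by filter_upwards [hu] with q hq hqI using hq ⟨hqI.1, hqI.2.trans heb⟩)

end Trajectory

/-- Theorem 5(b): strong `(h⁰,h)`-ISS of the switched impulsive family under
condition (25). -/
theorem stmt11 {n m : ℕ} {Ic Id : Type*}
    (F : Ic → ℝ → Stt n → Stt m → Stt n) (G : Id → ℝ → Stt n → Stt m → Stt n)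
    (h0 h : ℝ → Stt n → ℝ)
    (hh0 : ∀ (t : ℝ) (ξ : Stt n), 0 ≤ t → 0 ≤ h0 t ξ)
    (hh : ∀ (t : ℝ) (ξ : Stt n), 0 ≤ t → 0 ≤ h t ξ)
    (J : Set (Ic × Ic × Id)) (hJ : J.Nonempty)
    (SW : Set (SwSignal Ic Id)) (hSW : ∀ σ ∈ SW, InSW σ J)
    (Ics Icn Icu : Set Ic)
    (hIuniv : Ics ∪ Icn ∪ Icu = Set.univ)
    (hIdisj : Disjoint Ics Icn ∧ Disjoint Ics Icu ∧ Disjoint Icn Icu)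
    (Js Jn Ju : Set (Ic × Ic × Id))
    (hJuniv : Js ∪ Jn ∪ Ju = J)
    (hJdisj : Disjoint Js Jn ∧ Disjoint Js Ju ∧ Disjoint Jn Ju)
    (cs cu ds du : ℝ) (hcs : 0 < cs) (hcu : 0 < cu)
    (hds0 : 0 ≤ ds) (hds1 : ds < 1) (hdu : 1 < du)
    (v : Ic → ℝ → Stt n → ℝ) (φ1 φ2 χ π : ℝ → ℝ)
    (hA2 : Assumption2 F G h0 h J v φ1 φ2 χ π
      (fun i _ r => if i ∈ Ics then cs * r else if i ∈ Icn then 0 else -(cu * r))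
      (fun e _ r => if e ∈ Js then ds * r else if e ∈ Jn then r else du * r))
    (η μ : ℝ) (hη : 0 < η) (hμ : 0 < μ)
    (hcond : ∀ σ ∈ SW, ∀ t0 t : ℝ, 0 ≤ t0 → t0 ≤ t →
      (0 < ds ∨ nJumpsIn σ Js t0 t = 0) →
      (nJumpsIn σ Js t0 t : ℝ) * Real.log ds + (nJumpsIn σ Ju t0 t : ℝ) * Real.log du
        - cs * actT σ Ics t0 t + cu * actT σ Icu t0 t ≤
          μ - η * (t - t0 + (nJumps σ.γ t0 t : ℝ))) :
    SwStronglyISS F G SW h0 h := by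
  obtain ⟨hφ1, hφ2, hχ, hπ, hlip, -, -, hsand, hdini, hbig, hsmall⟩ := hA2
  obtain ⟨e, he0, he⟩ := hφ1.exists_orderIso
  have hes0 : e.symm 0 = 0 := (e.symm_apply_eq).2 he0.symm
  have hdu0 : 0 < du := one_pos.trans hdu
  refine ⟨fun r t => e.symm (Real.exp (μ - η * t) * φ2 r),
    fun r => e.symm (Real.exp μ * max (du * χ r) (π r)),
    classKL_orderIso_exp hφ2 e.symm hes0 hη,
    (((hχ.const_mul hdu0).max hπ).const_mul (Real.exp_pos μ)).orderIso_comp e.symm hes0, ?_⟩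
  intro σ hσ t0 x0 u T x ht0 hu hmax t htt hT
  have hsol := hmax.1
  set R := inputNorm σ.γ u (Ioc t0 t) with hR
  have hR0 : 0 ≤ R := inputNorm_nonneg _ _ _
  set C := max (du * χ R) (π R) with hC
  have hχR := hχ.nonneg hR0
  have hC0 : 0 ≤ C := le_max_of_le_left (mul_nonneg hdu0.le hχR)
  have hcC : χ R ≤ C := le_max_of_le_left (le_mul_of_one_le_left hχR hdu.le)
  set k : Ic → ℝ := fun i => if i ∈ Ics then -cs else if i ∈ Icn then 0 else cu with hk
  have hdini' : ∀ i t ξ (μ : Stt m), 0 ≤ t → χ ‖μ‖ ≤ v i t ξ →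
      DiniAlong (F i) (v i) t ξ μ ≤ k i * v i t ξ := by
    intro i s ξ ν hs hν
    refine (hdini i s ξ ν hs hν).trans_eq ?_
    simp only [hk]
    split_ifs <;> ring
  have hv0 : ∀ i s ξ, 0 ≤ s → 0 ≤ v i s ξ := fun i s ξ hs =>
    (hφ1.nonneg (hh s ξ hs)).trans (hsand i s ξ hs).1
  set P := growthFactor σ Ics Icu Js Ju cs cu ds du with hPdef
  have hP0 : ∀ a b, 0 ≤ P a b := growthFactor_nonneg σ hds0 hdu0.le
  have hmul : ∀ a b c, a ≤ b → b ≤ c → P b c * P a b = P a c := fun a b c =>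
    growthFactor_mul σ
  have hPle : ∀ s, t0 ≤ s → s ≤ t →
      P s t ≤ Real.exp (μ - η * (t - s + (nJumps σ.γ s t : ℝ))) := fun s hs hst =>
    growthFactor_le_exp σ hds0 hdu0 (hcond σ hσ s t (ht0.trans hs) hst)
  have huae : ∀ᵐ s, s ∈ Ioc t0 t → χ ‖u s‖ ≤ χ R := by
    filter_upwards [ae_norm_le_inputNorm (γ := σ.γ) (t := t) hu ht0] with s hs hsI
      using hχ.mono (norm_nonneg _) (hs hsI)
  have hPflow : ∀ a b, t0 ≤ a → a ≤ b → Ioc a b ∩ σ.γ = ∅ →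
      P a b = Real.exp (k (σ.σ1 a) * (b - a)) := by
    intro a b ha hab hγ
    have hmode := σ.σ1_eq_of_Ioc_inter_eq_empty (ht0.trans ha) hγ
    rw [hPdef, growthFactor_eq_of_const σ hIuniv hIdisj hab
      (fun r hr => hmode r (Ico_subset_Icc_self hr)), nJumpsIn_of_Ioc_inter_eq_empty σ Js hγ,
      nJumpsIn_of_Ioc_inter_eq_empty σ Ju hγ]
    simp [hk]
  have hgrowth : GrowthBound (fun s => v (σ.σ1 s) s (x s)) P C t0 t := by
    refine σ.rel_of_trans (S := GrowthBound (fun s => v (σ.σ1 s) s (x s)) P C)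
      (lo := t0) (hi := t)
      (fun a b c _ hab hbc _ => GrowthBound.trans hP0 hmul hab hbc) ?_ le_rfl htt le_rfl
    intro a b ha hab hbt hγ
    have hbT : (b : EReal) < T := lt_of_le_of_lt (EReal.coe_le_coe_iff.2 hbt) hT
    have huab : ∀ᵐ s, s ∈ Ioo a b → χ ‖u s‖ ≤ χ R := by
      filter_upwards [huae] with s hs hsI using hs ⟨ha.trans_lt hsI.1, hsI.2.le.trans hbt⟩
    rcases hab.eq_or_lt with rfl | hlt
    · left
      simp [hPdef, growthFactor_self]
    by_cases hb : b ∈ σ.γ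
    · have hb0 : 0 ≤ b := ht0.trans (ha.trans hab)
      have hmode : ∀ r ∈ Ico a b, σ.σ1 r = σ.σ1 a := σ.const1 a b (ht0.trans ha) hγ
      set E : Ic × Ic × Id := (σ.σ1m b, σ.σ1 b, σ.σ2 b) with hE
      have hEJ : E ∈ J := hSW σ hσ b hb
      set d : ℝ := if E ∈ Js then ds else if E ∈ Jn then 1 else du with hd
      have hd0 : 0 ≤ d := by rw [hd]; split_ifs <;> linarith
      have hdle : d ≤ du := by rw [hd]; split_ifs <;> linarith
      have hjump : ∀ ξ, χ ‖u b‖ ≤ v (σ.σ1m b) b ξ →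
          v (σ.σ1 b) b (ξ + G (σ.σ2 b) b ξ (u b)) ≤ d * v (σ.σ1m b) b ξ := by
        intro ξ hξ
        refine (hbig _ _ _ hEJ b ξ (u b) hb0 hξ).trans_eq ?_
        simp only [hd, hE]
        split_ifs <;> simp
      have hub : ‖u b‖ ≤ R := norm_le_inputNorm_of_mem σ.impulse ⟨hb, ha.trans_lt hlt, hbt⟩
      have hχub : χ ‖u b‖ ≤ χ R := hχ.mono (norm_nonneg _) hub
      refine hsol.growthBound_of_jump ht0 hlip hdini' hcC hd0 hP0 hmul ha hlt hbT hb hγ ?_ ?_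
        (growthFactor_self σ b) huab (fun ξ hξ => hjump ξ (hχub.trans hξ.le)) ?_
      · intro r s har hrs hsb
        rw [hPflow r s (ha.trans har) hrs, hmode r ⟨har, hrs.trans_lt hsb⟩]
        exact subset_empty_iff.1 <| hγ ▸ inter_subset_inter_left _ fun q hq =>
          ⟨har.trans_lt hq.1, hq.2.trans_lt hsb⟩
      · intro r har hrb
        have hγr : Ioo r b ∩ σ.γ = ∅ :=
          subset_empty_iff.1 <| hγ ▸ inter_subset_inter_left _ (Ioo_subset_Ioo_left har)
        rw [hPdef, growthFactor_eq_of_const σ hIuniv hIdisj hrb.le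
          (fun q hq => hmode q ⟨har.trans hq.1, hq.2⟩),
          nJumpsIn_of_Ioo_inter_eq_empty σ Js hrb hb hγr,
          nJumpsIn_of_Ioo_inter_eq_empty σ Ju hrb hb hγr, ← hE]
        congr 1
        have hEmem : (E ∈ Js ∨ E ∈ Jn) ∨ E ∈ Ju := by
          rw [← hJuniv] at hEJ
          exact hEJ
        have h1 := fun h : E ∈ Js => Set.disjoint_left.1 hJdisj.2.1 h
        have h2 := fun h : E ∈ Jn => Set.disjoint_left.1 hJdisj.2.2 h
        by_cases hs : E ∈ Js
        · simp [hd, hs, h1 hs]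
        · by_cases hn : E ∈ Jn
          · simp [hd, hs, hn, h2 hn]
          · have hEu : E ∈ Ju := by tauto
            simp [hd, hs, hn, hEu]
      · intro ξ hξ
        rcases le_total (χ ‖u b‖) (v (σ.σ1m b) b ξ) with hle | hle
        · calc v (σ.σ1 b) b (ξ + G (σ.σ2 b) b ξ (u b)) ≤ d * v (σ.σ1m b) b ξ := hjump ξ hle
            _ ≤ du * χ R := mul_le_mul hdle hξ (hv0 _ _ _ hb0) hdu0.le
            _ ≤ C := le_max_left _ _
        · exact (hsmall _ _ _ hEJ b ξ (u b) hb0 hle).trans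
            ((hπ.mono (norm_nonneg _) hub).trans (le_max_right _ _))
    · have hγ' : Ioc a b ∩ σ.γ = ∅ := by
        rw [← Ioo_union_right hlt, union_inter_distrib_right, hγ, empty_union]
        simpa using hb
      have hmode := σ.σ1_eq_of_Ioc_inter_eq_empty (ht0.trans ha) hγ'
      refine hsol.growthBound_of_flow ht0 hlip hdini' hcC ha hab hbT hγ' ?_ huab
      intro r hr
      rw [hPflow r b (ha.trans hr.1) hr.2, hmode r hr]
      exact subset_empty_iff.1 <| hγ' ▸ inter_subset_inter_left _ (Ioc_subset_Ioc_left hr.1)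
  have ht0t : 0 ≤ t := ht0.trans htt
  have hht : h t (x t) ≤ e.symm (v (σ.σ1 t) t (x t)) := by
    rw [e.le_symm_apply, he _ (hh t _ ht0t)]
    exact (hsand _ t _ ht0t).1
  have hφ20 := hφ2.nonneg (hh0 t0 x0 ht0)
  have hsymm0 : ∀ y, 0 ≤ y → 0 ≤ e.symm y := fun y hy => hes0 ▸ e.symm.monotone hy
  have hβ := hsymm0 _ (mul_nonneg
    (Real.exp_nonneg (μ - η * (t - t0 + (nJumps σ.γ t0 t : ℝ)))) hφ20)
  have hρ := hsymm0 _ (mul_nonneg (Real.exp_nonneg μ) hC0)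
  refine hht.trans ?_
  rcases hgrowth with hg | ⟨r, hr, hg⟩
  · refine le_add_of_le_of_nonneg (e.symm.monotone (hg.trans ?_)) hρ
    refine mul_le_mul (hPle t0 le_rfl htt) ?_ (hv0 _ _ _ ht0) (Real.exp_nonneg _)
    simp only [hsol.init]
    exact (hsand _ t0 x0 ht0).2
  · refine le_add_of_nonneg_of_le hβ (e.symm.monotone (hg.trans ?_))
    refine mul_le_mul_of_nonneg_right ((hPle r hr.1 hr.2).trans (Real.exp_le_exp.2 ?_)) hC0
    have : 0 ≤ η * (t - r + (nJumps σ.γ r t : ℝ)) :=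
      mul_nonneg hη.le (add_nonneg (sub_nonneg.2 hr.2) (Nat.cast_nonneg _))
    linarith

end
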